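/- arXiv:2505.21838 — 4 statements merged into one kernel-verified Lean document; each statement's English description precedes it below -/
import Mathlib

section
/- For any C^∞ functions ρ₁ : ℝ → ℝ, γ₁ : ℝ^{p₁} → ℝ, γ₂ : ℝ^{p₂} → ℝ with ρ₁ ≥ 1, γ₁ ≥ 1, γ₂ ≥ 1 everywhere, there exist a C^∞ strictly positive function ρ : ℝ → ℝ, a C¹ function V₁ : ℝ^{p₁}×ℝ×ℝ^{p₂} → ℝ, class-K∞ functions α̲ and ᾱ with α̲(‖(η̄₁,x̄₁,η̄₂)‖) ≤ V₁(η̄₁,x̄₁,η̄₂) ≤ ᾱ(‖(η̄₁,x̄₁,η̄₂)‖) for all (η̄₁,x̄₁,η̄₂), and a strictly positive C^∞ function β̂ : ℝ → ℝ, such that for all η̄₁ ∈ ℝ^{p₁}, x̄₁ ∈ ℝ, η̄₂ ∈ ℝ^{p₂}, ζ ∈ ℝ, and μ ∈ K, the derivative of V₁ along the vector field of the subsystem satisfies: ∇_{η̄₁}V₁ · (M₁η̄₁ + M₁N₁x̄₁) + (∂V₁/∂x̄₁) · (ζ − ρ(x̄₁)x̄₁ + χ̃₁(η̄₁,x̄₁))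 + ∇_{η̄₂}V₁ · (M₂η̄₂ + p̃(x̄₁,η̄₁,ζ,μ)) ≤ −ρ₁(x̄₁)x̄₁² − γ₁(η̄₁)‖η̄₁‖² − γ₂(η̄₂)‖η̄₂‖² + (β̂(ζ) + 2)ζ². -/
open Matrix

/-- A real square matrix is Hurwitz if every eigenvalue of it (over `ℂ`) has negative
real part. -/
def IsHurwitz {q : ℕ} (M : Matrix (Fin q) (Fin q) ℝ) : Prop :=
  ∀ z ∈ spectrum ℂ (M.map (algebraMap ℝ ℂ)), z.re < 0

/-- A function `α : [0,∞) → [0,∞)` is of class `K∞`: continuous, strictly increasing,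
`α(0) = 0`, and unbounded. (Stated for `α : ℝ → ℝ` on `[0,∞)`.) -/
def IsClassKInfty (α : ℝ → ℝ) : Prop :=
  ContinuousOn α (Set.Ici 0) ∧ StrictMonoOn α (Set.Ici 0) ∧ α 0 = 0 ∧
    (∀ s ∈ Set.Ici (0 : ℝ), 0 ≤ α s) ∧ Filter.Tendsto α Filter.atTop Filter.atTop

open Filter Topology

theorem exists_smooth_gt {f : ℝ → ℝ} (hf : Continuous f) :
    ∃ g : ℝ → ℝ, ContDiff ℝ (⊤ : ℕ∞) g ∧ ∀ x, f x < g x := by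
  obtain ⟨g, hg⟩ := exists_contMDiffMap_forall_mem_convex_of_local_const
    (I := modelWithCornersSelf ℝ ℝ) (n := (⊤ : ℕ∞)) (t := fun x => Set.Ioi (f x))
    (fun x => convex_Ioi _) (fun x => ⟨f x + 1, by
      have h : Tendsto f (𝓝 x) (𝓝 (f x)) := hf.continuousAt
      exact h.eventually_lt_const (by linarith : f x < f x + 1)⟩)
  exact ⟨g, g.contMDiff.contDiff, hg⟩

theorem exists_continuous_monotone_bound {E Y : Type*} [NormedAddCommGroup E] [NormedSpace ℝ E]
    [ProperSpace E] [TopologicalSpace Y] {f : E × Y → ℝ} (hf : Continuous f)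
    {K : Set Y} (hK : IsCompact K) :
    ∃ m : ℝ → ℝ, Continuous m ∧ Monotone m ∧ (∀ r, 1 ≤ m r) ∧
      ∀ x, ∀ y ∈ K, f (x, y) ≤ m ‖x‖ := by
  have hS : IsCompact (Metric.closedBall (0 : E) 1 ×ˢ K) := (isCompact_closedBall 0 1).prod hK
  let F : ℝ → E × Y → ℝ := fun r z => max 1 (f (max r 0 • z.1, z.2))
  have hF : Continuous ↿F := by
    change Continuous fun w : ℝ × E × Y => max 1 (f (max w.1 0 • w.2.1, w.2.2))
    fun_prop
  have hbdd : ∀ r, BddAbove (F r '' (Metric.closedBall (0 : E) 1 ×ˢ K)) := fun r =>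
    (hS.image (hF.comp (by fun_prop : Continuous fun z : E × Y => (r, z)))).bddAbove
  have key : ∀ r, ∀ x : E, ‖x‖ ≤ max r 0 → ∀ y ∈ K,
      max 1 (f (x, y)) ≤ sSup (F r '' (Metric.closedBall (0 : E) 1 ×ˢ K)) := by
    intro r x hx y hy
    refine le_csSup (hbdd r) ⟨((max r 0)⁻¹ • x, y), ⟨?_, hy⟩, ?_⟩
    · rw [mem_closedBall_zero_iff, norm_smul, norm_inv, Real.norm_of_nonneg (le_max_right r 0)]
      exact inv_mul_le_one_of_le₀ hx (le_max_right r 0)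
    · rcases eq_or_ne (max r 0) 0 with h0 | h0
      · have : x = 0 := by simpa [h0] using hx
        simp [F, this]
      · simp [F, smul_smul, mul_inv_cancel₀ h0]
  refine ⟨fun r => max 1 (sSup (F r '' (Metric.closedBall (0 : E) 1 ×ˢ K))),
    continuous_const.max (hS.continuous_sSup hF), ?_, fun r => le_max_left _ _, ?_⟩
  · intro r s hrs
    refine max_le (le_max_left _ _) ?_
    rcases (F r '' (Metric.closedBall (0 : E) 1 ×ˢ K)).eq_empty_or_nonempty with h | h
    · rw [h, Real.sSup_empty]; exact zero_le_one.trans (le_max_left _ _)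
    · refine csSup_le h ?_
      rintro _ ⟨⟨x, y⟩, ⟨hx, hy⟩, rfl⟩
      refine (key s (max r 0 • x) ?_ y hy).trans (le_max_right _ _)
      rw [norm_smul, Real.norm_of_nonneg (le_max_right r 0)]
      have hx1 : ‖x‖ ≤ 1 := by simpa using hx
      exact (mul_le_of_le_one_right (le_max_right r 0) hx1).trans (max_le_max_right 0 hrs)
  · intro x y hy
    exact (le_max_right _ _).trans ((key ‖x‖ x (le_max_left _ _) y hy).trans (le_max_right _ _))

theorem exists_continuous_monotone_growth_bound {E Y F : Type*} [NormedAddCommGroup E]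
    [NormedSpace ℝ E] [ProperSpace E] [NormedAddCommGroup Y] [NormedSpace ℝ Y]
    [NormedAddCommGroup F] [NormedSpace ℝ F] {p : E × Y → F} (hp : ContDiff ℝ 1 p)
    {K : Set Y} (hK : IsCompact K) (h0 : ∀ y ∈ K, p (0, y) = 0) :
    ∃ L : ℝ → ℝ, Continuous L ∧ Monotone L ∧ (∀ r, 1 ≤ L r) ∧
      ∀ x, ∀ y ∈ K, ‖p (x, y)‖ ≤ L ‖x‖ * ‖x‖ := by
  obtain ⟨L, hLc, hLm, hL1, hL⟩ := exists_continuous_monotone_bound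
    (f := fun z => ‖fderiv ℝ p z‖) (hp.continuous_fderiv one_ne_zero).norm hK
  refine ⟨L, hLc, hLm, hL1, fun x y hy => ?_⟩
  have h := Convex.norm_image_sub_le_of_norm_fderiv_le (𝕜 := ℝ) (f := p) (C := L ‖x‖)
    (s := Metric.closedBall (0 : E) ‖x‖ ×ˢ {y}) (x := (0, y)) (y := (x, y))
    (fun z _ => hp.differentiable one_ne_zero z) ?_
    ((convex_closedBall _ _).prod (convex_singleton y)) (by simp) (by simp)
  · simpa [h0 y hy] using h
  · rintro ⟨u, v⟩ ⟨hu, rfl⟩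
    exact (hL u v hy).trans (hLm (by simpa using hu))

section
open scoped Matrix.Norms.Operator NNReal ENNReal

theorem tendsto_norm_pow_of_spectralRadius_lt_one {A : Type*} [NormedRing A] [NormedAlgebra ℂ A]
    [CompleteSpace A] {a : A} (ha : spectralRadius ℂ a < 1) :
    Tendsto (fun n : ℕ => ‖a ^ n‖) atTop (𝓝 0) := by
  obtain ⟨r, har, hr⟩ := ENNReal.lt_iff_exists_nnreal_btwn.1 ha
  have hr1 : (r : ℝ) < 1 := by exact_mod_cast hr
  refine squeeze_zero' (Eventually.of_forall fun n => norm_nonneg _) ?_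
    (tendsto_pow_atTop_nhds_zero_of_lt_one r.coe_nonneg hr1)
  filter_upwards [(spectrum.pow_nnnorm_pow_one_div_tendsto_nhds_spectralRadius a).eventually_lt_const
    har, eventually_gt_atTop 0] with n hn hn0
  have hn0' : (0 : ℝ) < n := by exact_mod_cast hn0
  rw [one_div, ← ENNReal.lt_rpow_inv_iff (inv_pos.2 hn0'), inv_inv, ENNReal.rpow_natCast] at hn
  have : ‖a ^ n‖₊ < r ^ n := by exact_mod_cast hn
  exact_mod_cast this.le

theorem IsHurwitz.exists_norm_one_add_smul_pow_mulVec_le {q : ℕ} (hq : 1 ≤ q)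
    {M : Matrix (Fin q) (Fin q) ℝ} (hM : IsHurwitz M) :
    ∃ h : ℝ, 0 < h ∧ ∀ ε : ℝ, 0 < ε → ∃ n : ℕ, ∀ x : Fin q → ℝ,
      ‖((1 + h • M) ^ n) *ᵥ x‖ ≤ ε * ‖x‖ := by
  have : Nonempty (Fin q) := ⟨⟨0, hq⟩⟩
  set C := M.map (algebraMap ℝ ℂ) with hC
  have hev : ∀ᶠ h : ℝ in 𝓝[>] 0, ∀ z ∈ spectrum ℂ C, ‖1 + (h : ℂ) * z‖ < 1 := by
    rw [(Matrix.finite_spectrum C).eventually_all]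
    intro z hz
    have hz := hM z hz
    have h1 : ∀ᶠ h : ℝ in 𝓝[>] 0, 2 * z.re + h * ‖z‖ ^ 2 < 0 := by
      have : Tendsto (fun h : ℝ => 2 * z.re + h * ‖z‖ ^ 2) (𝓝[>] 0) (𝓝 (2 * z.re + 0 * ‖z‖ ^ 2)) :=
        (Continuous.tendsto (by fun_prop) 0).mono_left nhdsWithin_le_nhds
      exact this.eventually_lt_const (by linarith)
    filter_upwards [h1, self_mem_nhdsWithin] with h hh hpos
    have hpos : 0 < h := hpos
    have : ‖1 + (h : ℂ) * z‖ ^ 2 = 1 + h * (2 * z.re + h * ‖z‖ ^ 2) := by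
      rw [Complex.sq_norm, Complex.sq_norm, Complex.normSq_apply, Complex.normSq_apply]
      simp
      ring
    nlinarith [norm_nonneg (1 + (h : ℂ) * z), mul_neg_of_pos_of_neg hpos hh]
  obtain ⟨h, hh, hpos⟩ := (hev.and self_mem_nhdsWithin).exists
  have hpos : 0 < h := hpos
  refine ⟨h, hpos, fun ε hε => ?_⟩
  have hrad : spectralRadius ℂ (1 + (h : ℂ) • C) < 1 := by
    refine mod_cast spectrum.spectralRadius_lt_of_forall_lt (1 + (h : ℂ) • C) (r := 1) ?_
    intro z hz
    have hne : (h : ℂ) ≠ 0 := by exact_mod_cast hpos.ne'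
    have hmem : (z - 1) / h ∈ spectrum ℂ C := by
      rw [spectrum.mem_iff] at hz ⊢
      contrapose! hz
      have : algebraMap ℂ (Matrix (Fin q) (Fin q) ℂ) z - (1 + (h : ℂ) • C) =
          (Units.mk0 (h : ℂ) hne) • (algebraMap ℂ (Matrix (Fin q) (Fin q) ℂ) ((z - 1) / h) - C) := by
        rw [Units.smul_mk0, smul_sub, Algebra.algebraMap_eq_smul_one, Algebra.algebraMap_eq_smul_one,
          smul_smul, mul_div_cancel₀ _ hne, sub_smul, one_smul]
        abel
      rw [this]
      exact hz.smul _
    have := hh _ hmem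
    rw [mul_div_cancel₀ _ hne] at this
    simpa [← NNReal.coe_lt_coe] using this
  obtain ⟨n, hn⟩ := ((tendsto_norm_pow_of_spectralRadius_lt_one hrad).eventually_lt_const hε).exists
  refine ⟨n, fun x => (Matrix.linfty_opNorm_mulVec _ _).trans ?_⟩
  refine mul_le_mul_of_nonneg_right (le_trans (le_of_eq ?_) hn.le) (norm_nonneg _)
  have hmap : (1 + (h : ℂ) • C) ^ n = ((1 + h • M) ^ n).map (algebraMap ℝ ℂ) := by
    rw [Matrix.map_pow]
    congr 1
    ext i j
    by_cases hij : i = j <;> simp [hC, hij]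
  rw [hmap]
  simp [Matrix.linfty_opNorm_def]
end

theorem norm_sq_le_dotProduct_self {q : ℕ} (x : Fin q → ℝ) : ‖x‖ ^ 2 ≤ x ⬝ᵥ x := by
  have h0 : 0 ≤ x ⬝ᵥ x := Finset.sum_nonneg fun i _ => mul_self_nonneg _
  have : ‖x‖ ≤ √(x ⬝ᵥ x) := (pi_norm_le_iff_of_nonneg (Real.sqrt_nonneg _)).2 fun i => by
    refine Real.abs_le_sqrt ?_
    rw [sq]
    exact Finset.single_le_sum (f := fun i => x i * x i) (fun i _ => mul_self_nonneg _)
      (Finset.mem_univ i)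
  calc ‖x‖ ^ 2 ≤ √(x ⬝ᵥ x) ^ 2 := by gcongr
    _ = _ := Real.sq_sqrt h0

theorem dotProduct_self_le_card_mul_norm_sq {q : ℕ} (x : Fin q → ℝ) :
    x ⬝ᵥ x ≤ q * ‖x‖ ^ 2 := by
  calc x ⬝ᵥ x ≤ ∑ _i : Fin q, ‖x‖ ^ 2 := Finset.sum_le_sum fun i _ => by
        rw [← sq, ← sq_abs]
        exact pow_le_pow_left₀ (abs_nonneg _) (norm_le_pi_norm x i) 2
    _ = _ := by simp

/-- The bilinear form `(x, y) ↦ ∑ n < N, ⟨Aⁿ x, Aⁿ y⟩`. -/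
def orbitForm {q : ℕ} (A : Matrix (Fin q) (Fin q) ℝ) (N : ℕ) :
    (Fin q → ℝ) →ₗ[ℝ] (Fin q → ℝ) →ₗ[ℝ] ℝ :=
  LinearMap.mk₂ ℝ (fun x y => ∑ n ∈ Finset.range N, ((A ^ n) *ᵥ x) ⬝ᵥ ((A ^ n) *ᵥ y))
    (by simp [mulVec_add, add_dotProduct, Finset.sum_add_distrib])
    (by simp [mulVec_smul, Finset.mul_sum])
    (by simp [mulVec_add, dotProduct_add, Finset.sum_add_distrib])
    (by simp [mulVec_smul, Finset.mul_sum])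

theorem orbitForm_apply {q : ℕ} (A : Matrix (Fin q) (Fin q) ℝ) (N : ℕ) (x y : Fin q → ℝ) :
    orbitForm A N x y = ∑ n ∈ Finset.range N, ((A ^ n) *ᵥ x) ⬝ᵥ ((A ^ n) *ᵥ y) := rfl

theorem orbitForm_comm {q : ℕ} (A : Matrix (Fin q) (Fin q) ℝ) (N : ℕ) (x y : Fin q → ℝ) :
    orbitForm A N x y = orbitForm A N y x := by
  simp only [orbitForm_apply, dotProduct_comm]

theorem orbitForm_self_nonneg {q : ℕ} (A : Matrix (Fin q) (Fin q) ℝ) (N : ℕ) (x : Fin q → ℝ) :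
    0 ≤ orbitForm A N x x := by
  rw [orbitForm_apply]
  exact Finset.sum_nonneg fun _ _ => Finset.sum_nonneg fun _ _ => mul_self_nonneg _

theorem orbitForm_mulVec_self {q : ℕ} (A : Matrix (Fin q) (Fin q) ℝ) (N : ℕ) (x : Fin q → ℝ) :
    orbitForm A N (A *ᵥ x) (A *ᵥ x) =
      orbitForm A N x x + ((A ^ N) *ᵥ x) ⬝ᵥ ((A ^ N) *ᵥ x) - x ⬝ᵥ x := by
  have h := Finset.sum_range_succ (fun n => ((A ^ n) *ᵥ x) ⬝ᵥ ((A ^ n) *ᵥ x)) N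
  rw [Finset.sum_range_succ'] at h
  simp only [pow_zero, one_mulVec] at h
  simp only [orbitForm_apply, mulVec_mulVec, ← pow_succ]
  linarith

/-- A Hurwitz matrix admits a quadratic Lyapunov form. -/
theorem IsHurwitz.exists_lyapunov_form {q : ℕ} (hq : 1 ≤ q)
    {M : Matrix (Fin q) (Fin q) ℝ} (hM : IsHurwitz M) :
    ∃ B : (Fin q → ℝ) →L[ℝ] (Fin q → ℝ) →L[ℝ] ℝ, ∃ a : ℝ, 0 < a ∧
      (∀ x y, B x y = B y x) ∧ (∀ x, a * ‖x‖ ^ 2 ≤ B x x) ∧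
      ∀ x, B x (M *ᵥ x) ≤ -‖x‖ ^ 2 := by
  obtain ⟨h, hpos, hdecay⟩ := hM.exists_norm_one_add_smul_pow_mulVec_le hq
  have hq' : (1 : ℝ) ≤ q := by exact_mod_cast hq
  set A := 1 + h • M with hA
  obtain ⟨N, hN⟩ := hdecay (1 / (2 * q)) (by positivity)
  have hstep : ∀ x : Fin q → ℝ, ((A ^ N) *ᵥ x) ⬝ᵥ ((A ^ N) *ᵥ x) ≤ 1 / 2 * ‖x‖ ^ 2 := fun x =>
    calc ((A ^ N) *ᵥ x) ⬝ᵥ ((A ^ N) *ᵥ x) ≤ q * ‖(A ^ N) *ᵥ x‖ ^ 2 :=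
          dotProduct_self_le_card_mul_norm_sq _
      _ ≤ q * (1 / (2 * q) * ‖x‖) ^ 2 := by gcongr; exact hN x
      _ = 1 / (4 * q) * ‖x‖ ^ 2 := by field_simp; ring
      _ ≤ 1 / 2 * ‖x‖ ^ 2 := by gcongr; linarith
  have hsub : ∀ x : Fin q → ℝ, ‖x‖ ^ 2 / 2 ≤
      orbitForm A N x x - orbitForm A N (A *ᵥ x) (A *ᵥ x) := fun x => by
    rw [orbitForm_mulVec_self]
    linarith [hstep x, norm_sq_le_dotProduct_self x]
  refine ⟨((4 * h) • orbitForm A N).toContinuousBilinearMap, 2 * h, by positivity,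
    fun x y => ?_, fun x => ?_, fun x => ?_⟩
  · simp [orbitForm_comm A N x y]
  · have h1 := hsub x
    have h2 := orbitForm_self_nonneg A N (A *ᵥ x)
    simp only [LinearMap.toContinuousBilinearMap_apply, LinearMap.smul_apply, smul_eq_mul]
    nlinarith
  · have h1 := hsub x
    have h2 := orbitForm_self_nonneg A N (M *ᵥ x)
    have hAx : A *ᵥ x = x + h • (M *ᵥ x) := by rw [hA, add_mulVec, one_mulVec, smul_mulVec]
    rw [hAx] at h1
    simp only [map_add, LinearMap.add_apply, map_smul, LinearMap.smul_apply, smul_eq_mul,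
      orbitForm_comm A N (M *ᵥ x) x] at h1
    simp only [LinearMap.toContinuousBilinearMap_apply, LinearMap.smul_apply, smul_eq_mul]
    nlinarith [mul_nonneg (mul_nonneg hpos.le hpos.le) h2]

/-- Changing the supply rate of a linear exponentially stable system with additive input: the decay
rate can be prescribed to dominate any `g ‖x‖ * ‖x‖ ^ 2` with `g` continuous and monotone. -/
theorem IsHurwitz.exists_iss_lyapunov {q : ℕ} (hq : 1 ≤ q)
    {M : Matrix (Fin q) (Fin q) ℝ} (hM : IsHurwitz M)
    {g : ℝ → ℝ} (hgc : Continuous g) (hgm : Monotone g) (hg1 : ∀ r, 1 ≤ g r) :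
    ∃ V : (Fin q → ℝ) → ℝ, ContDiff ℝ 1 V ∧ ∃ a : ℝ, 0 < a ∧
      ∃ U G : ℝ → ℝ, Continuous U ∧ Monotone U ∧ (∀ r, 0 ≤ U r) ∧
        Continuous G ∧ Monotone G ∧ (∀ r, 0 ≤ G r) ∧
        (∀ x, a * ‖x‖ ^ 2 ≤ V x) ∧ (∀ x, V x ≤ U ‖x‖ * ‖x‖ ^ 2) ∧
        ∀ x v, fderiv ℝ V x (M *ᵥ x + v) ≤ -(g ‖x‖ * ‖x‖ ^ 2) + G ‖v‖ * ‖v‖ ^ 2 := by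
  obtain ⟨B, a, ha, hsymm, hlow, hdec⟩ := hM.exists_lyapunov_form hq
  set b := ‖B‖
  have hb0 : 0 ≤ b := norm_nonneg B
  have hup : ∀ x, B x x ≤ b * ‖x‖ ^ 2 := fun x => by
    have := (le_abs_self _).trans (B.le_opNorm₂ x x)
    rwa [mul_assoc, ← sq] at this
  have hW0 : ∀ x, 0 ≤ B x x := fun x => le_trans (by positivity) (hlow x)
  let k : ℝ → ℝ := fun s => g √(s / a)
  have hkc : Continuous k := by fun_prop
  have hkm : Monotone k := fun s t hst => hgm (Real.sqrt_le_sqrt (by gcongr))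
  have hk1 : ∀ s, 1 ≤ k s := fun s => hg1 _
  have hkint : ∀ s t, IntervalIntegrable k MeasureTheory.volume s t :=
    fun s t => hkc.intervalIntegrable s t
  let κ : ℝ → ℝ := fun s => ∫ t in (0 : ℝ)..s, k t
  have hκ : ∀ s, HasDerivAt κ (k s) s := fun s => hkc.integral_hasStrictDerivAt 0 s |>.hasDerivAt
  have hκ1 : ContDiff ℝ 1 κ := contDiff_one_iff_deriv.2
    ⟨fun s => (hκ s).differentiableAt, by rwa [funext fun s => (hκ s).deriv]⟩
  have hκlow : ∀ s, 0 ≤ s → s ≤ κ s := fun s hs => by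
    simpa using intervalIntegral.integral_mono_on hs (by simp) (hkint 0 s) fun t _ => hk1 t
  have hκup : ∀ s, 0 ≤ s → κ s ≤ k s * s := fun s hs => by
    have := intervalIntegral.integral_mono_on hs (hkint 0 s)
      (intervalIntegrable_const (c := k s)) fun t ht => hkm ht.2
    simpa [mul_comm] using this
  have hWd : ∀ x, HasFDerivAt (fun y => B y y) (B x + B.flip x) x := fun x => by
    have := B.hasFDerivAt_of_bilinear (hasFDerivAt_id x) (hasFDerivAt_id x)
    refine this.congr_fderiv ?_
    ext v
    simp
  have hW1 : ContDiff ℝ 1 fun y => B y y := by fun_prop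
  have hVd : ∀ x v, fderiv ℝ (fun y => κ (B y y)) x v = k (B x x) * (2 * B x v) := fun x v => by
    refine (DFunLike.congr_fun (HasDerivAt.comp_hasFDerivAt (f := fun y => B y y) x
      (hκ (B x x)) (hWd x)).fderiv v).trans ?_
    simp [hsymm v x, two_mul, mul_add]
  let U : ℝ → ℝ := fun r => k (b * max r 0 ^ 2) * b
  let G : ℝ → ℝ := fun r => k (b * (2 * b * max r 0) ^ 2) * b ^ 2
  refine ⟨fun y => κ (B y y), hκ1.comp hW1, a, ha, U, G, by fun_prop, ?_, ?_, by fun_prop, ?_, ?_,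
    fun x => (hlow x).trans (hκlow _ (hW0 x)), fun x => ?_, fun x v => ?_⟩
  · intro r s hrs
    have : max r 0 ≤ max s 0 := max_le_max_right 0 hrs
    exact mul_le_mul_of_nonneg_right (hkm (by gcongr)) hb0
  · exact fun r => mul_nonneg (zero_le_one.trans (hk1 _)) hb0
  · intro r s hrs
    have : max r 0 ≤ max s 0 := max_le_max_right 0 hrs
    exact mul_le_mul_of_nonneg_right (hkm (by gcongr)) (sq_nonneg b)
  · exact fun r => mul_nonneg (zero_le_one.trans (hk1 _)) (sq_nonneg b)
  · calc κ (B x x) ≤ k (B x x) * B x x := hκup _ (hW0 x)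
      _ ≤ k (b * ‖x‖ ^ 2) * (b * ‖x‖ ^ 2) :=
        mul_le_mul (hkm (hup x)) (hup x) (hW0 x) (zero_le_one.trans (hk1 _))
      _ = U ‖x‖ * ‖x‖ ^ 2 := by simp only [U, max_eq_left (norm_nonneg x)]; ring
  · rw [hVd, map_add]
    have hBv : B x v ≤ b * ‖x‖ * ‖v‖ := (le_abs_self _).trans (B.le_opNorm₂ x v)
    have hk0 : 0 ≤ k (B x x) := zero_le_one.trans (hk1 _)
    have hmain : 2 * (B x (M *ᵥ x) + B x v) ≤ -‖x‖ ^ 2 + b ^ 2 * ‖v‖ ^ 2 := by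
      nlinarith [hdec x, sq_nonneg (‖x‖ - b * ‖v‖)]
    have hgk : g ‖x‖ ≤ k (B x x) := hgm <| Real.le_sqrt_of_sq_le <| by
      rw [le_div_iff₀ ha]
      linarith [hlow x]
    have hG : 0 ≤ G ‖v‖ * ‖v‖ ^ 2 :=
      mul_nonneg (mul_nonneg (zero_le_one.trans (hk1 _)) (sq_nonneg b)) (sq_nonneg _)
    have hgx : g ‖x‖ * ‖x‖ ^ 2 ≤ k (B x x) * ‖x‖ ^ 2 := by gcongr
    rcases le_total (2 * b * ‖v‖) ‖x‖ with hvx | hvx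
    · have h : 2 * (B x (M *ᵥ x) + B x v) ≤ -‖x‖ ^ 2 := by
        nlinarith [hdec x, mul_le_mul_of_nonneg_left hvx (norm_nonneg x)]
      nlinarith [mul_le_mul_of_nonneg_left h hk0]
    · have hW : B x x ≤ b * (2 * b * ‖v‖) ^ 2 := (hup x).trans (by gcongr)
      have hGv : k (B x x) * (b ^ 2 * ‖v‖ ^ 2) ≤ G ‖v‖ * ‖v‖ ^ 2 := by
        simp only [G, max_eq_left (norm_nonneg v), mul_assoc (k _)]
        exact mul_le_mul_of_nonneg_right (hkm hW) (by positivity)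
      nlinarith [mul_le_mul_of_nonneg_left hmain hk0]

theorem isClassKInfty_mul_sq {u : ℝ → ℝ} (huc : Continuous u) (hum : Monotone u) {c : ℝ}
    (hc : 0 < c) (hu : ∀ s, c ≤ u s) : IsClassKInfty fun s => u s * s ^ 2 := by
  refine ⟨by fun_prop, fun s hs t _ hst => ?_, by simp,
    fun s _ => mul_nonneg (hc.le.trans (hu s)) (sq_nonneg s), ?_⟩
  · have hs : 0 ≤ s := hs
    exact mul_lt_mul' (hum hst.le) (by gcongr) (sq_nonneg s) (hc.trans_le (hu t))
  · refine tendsto_atTop_mono (fun s => mul_le_mul_of_nonneg_right (hu s) (sq_nonneg s)) ?_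
    exact (tendsto_pow_atTop two_ne_zero).const_mul_atTop hc

theorem mul_sq_norm_prod_le {E F : Type*} [NormedAddCommGroup E] [NormedAddCommGroup F]
    {H : ℝ → ℝ} (hH : ∀ r, 0 ≤ H r) (z : E × F) :
    H ‖z‖ * ‖z‖ ^ 2 ≤ H ‖z.1‖ * ‖z.1‖ ^ 2 + H ‖z.2‖ * ‖z.2‖ ^ 2 := by
  have h1 := mul_nonneg (hH ‖z.1‖) (sq_nonneg ‖z.1‖)
  have h2 := mul_nonneg (hH ‖z.2‖) (sq_nonneg ‖z.2‖)
  rw [Prod.norm_def]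
  rcases max_choice ‖z.1‖ ‖z.2‖ with h | h <;> rw [h] <;> linarith

/-- Lemma 2: changing-supply-rate ISS-Lyapunov function for the
internal-model error subsystem
`η̄₁' = M₁η̄₁ + M₁N₁x̄₁`, `x̄₁' = ζ − ρ(x̄₁)x̄₁ + χ̃₁(η̄₁,x̄₁)`, `η̄₂' = M₂η̄₂ + p̃(x̄₁,η̄₁,ζ,μ)`. -/
theorem iss_lyapunov_for_error_subsystem
    {p₁ p₂ d : ℕ} (hp₁ : 1 ≤ p₁) (hp₂ : 1 ≤ p₂) (hd : 1 ≤ d)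
    (M₁ : Matrix (Fin p₁) (Fin p₁) ℝ) (hM₁ : IsHurwitz M₁)
    (M₂ : Matrix (Fin p₂) (Fin p₂) ℝ) (hM₂ : IsHurwitz M₂)
    (N₁ : Fin p₁ → ℝ)
    (K : Set (Fin d → ℝ)) (hK : IsCompact K)
    (χ₁' : (Fin p₁ → ℝ) × ℝ → ℝ) (hχ₁'_smooth : ContDiff ℝ (⊤ : ℕ∞) χ₁') (hχ₁'0 : χ₁' (0, 0) = 0)
    (p' : ℝ × (Fin p₁ → ℝ) × ℝ × (Fin d → ℝ) → (Fin p₂ → ℝ))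
    (hp'_smooth : ContDiff ℝ (⊤ : ℕ∞) p') (hp'0 : ∀ μ ∈ K, p' (0, 0, 0, μ) = 0)
    (ρ₁ : ℝ → ℝ) (hρ₁_smooth : ContDiff ℝ (⊤ : ℕ∞) ρ₁) (hρ₁ : ∀ s, 1 ≤ ρ₁ s)
    (γ₁ : (Fin p₁ → ℝ) → ℝ) (hγ₁_smooth : ContDiff ℝ (⊤ : ℕ∞) γ₁) (hγ₁ : ∀ x, 1 ≤ γ₁ x)
    (γ₂ : (Fin p₂ → ℝ) → ℝ) (hγ₂_smooth : ContDiff ℝ (⊤ : ℕ∞) γ₂) (hγ₂ : ∀ x, 1 ≤ γ₂ x) :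
    ∃ (ρ : ℝ → ℝ), ContDiff ℝ (⊤ : ℕ∞) ρ ∧ (∀ s, 0 < ρ s) ∧
    ∃ (V₁ : (Fin p₁ → ℝ) × ℝ × (Fin p₂ → ℝ) → ℝ), ContDiff ℝ 1 V₁ ∧
    ∃ (α₀ α₁ : ℝ → ℝ), IsClassKInfty α₀ ∧ IsClassKInfty α₁ ∧
      (∀ z : (Fin p₁ → ℝ) × ℝ × (Fin p₂ → ℝ), α₀ ‖z‖ ≤ V₁ z ∧ V₁ z ≤ α₁ ‖z‖) ∧
    ∃ (β : ℝ → ℝ), ContDiff ℝ (⊤ : ℕ∞) β ∧ (∀ s, 0 < β s) ∧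
      ∀ (η₁ : Fin p₁ → ℝ) (x₁ : ℝ) (η₂ : Fin p₂ → ℝ) (ζ : ℝ), ∀ μ ∈ K,
        fderiv ℝ V₁ (η₁, x₁, η₂)
            (M₁.mulVec η₁ + x₁ • M₁.mulVec N₁,
             ζ - ρ x₁ * x₁ + χ₁' (η₁, x₁),
             M₂.mulVec η₂ + p' (x₁, η₁, ζ, μ))
          ≤ -ρ₁ x₁ * x₁ ^ 2 - γ₁ η₁ * ‖η₁‖ ^ 2 - γ₂ η₂ * ‖η₂‖ ^ 2
              + (β ζ + 2) * ζ ^ 2 := by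
  obtain ⟨mγ₁, hmγ₁c, hmγ₁m, hmγ₁1, hmγ₁⟩ := exists_continuous_monotone_bound
    (f := fun z : (Fin p₁ → ℝ) × ℝ => γ₁ z.1) (hγ₁_smooth.continuous.comp continuous_fst)
    (isCompact_singleton (x := 0))
  obtain ⟨mγ₂, hmγ₂c, hmγ₂m, hmγ₂1, hmγ₂⟩ := exists_continuous_monotone_bound
    (f := fun z : (Fin p₂ → ℝ) × ℝ => γ₂ z.1) (hγ₂_smooth.continuous.comp continuous_fst)
    (isCompact_singleton (x := 0))
  have hsm : (1 : WithTop ℕ∞) ≤ ((⊤ : ℕ∞) : WithTop ℕ∞) := by exact_mod_cast le_top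
  have hχ1 : ContDiff ℝ 1 χ₁' := hχ₁'_smooth.of_le hsm
  have hp1 : ContDiff ℝ 1 p' := hp'_smooth.of_le hsm
  obtain ⟨Lχ, hLχc, hLχm, hLχ1, hLχ⟩ := exists_continuous_monotone_growth_bound
    (p := fun w : ((Fin p₁ → ℝ) × ℝ) × ℝ => χ₁' w.1) (by fun_prop)
    (isCompact_singleton (x := 0)) (fun _ _ => hχ₁'0)
  obtain ⟨Lp, hLpc, hLpm, hLp1, hLp⟩ := exists_continuous_monotone_growth_bound
    (p := fun w : (ℝ × (Fin p₁ → ℝ) × ℝ) × (Fin d → ℝ) =>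
      p' (w.1.1, w.1.2.1, w.1.2.2, w.2)) (by fun_prop) hK (fun μ hμ => hp'0 μ hμ)
  obtain ⟨V₂, hV₂c, a₂, ha₂, U₂, G₂, hU₂c, hU₂m, hU₂0, hG₂c, hG₂m, hG₂0, hV₂low, hV₂up, hV₂d⟩ :=
    hM₂.exists_iss_lyapunov hp₂ hmγ₂c hmγ₂m hmγ₂1
  let H : ℝ → ℝ := fun r => G₂ (Lp r * max r 0) * Lp r ^ 2
  have hHc : Continuous H := by fun_prop
  have hH0 : ∀ r, 0 ≤ H r := fun r => mul_nonneg (hG₂0 _) (sq_nonneg _)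
  have hLp0 : ∀ r, 0 ≤ Lp r := fun r => zero_le_one.trans (hLp1 r)
  have hHm : Monotone H := fun r s hrs => by
    have h1 : Lp r * max r 0 ≤ Lp s * max s 0 :=
      mul_le_mul (hLpm hrs) (max_le_max_right 0 hrs) (le_max_right _ _) (hLp0 s)
    exact mul_le_mul (hG₂m h1) (pow_le_pow_left₀ (hLp0 r) (hLpm hrs) 2) (sq_nonneg _) (hG₂0 _)
  have hLχ0 : ∀ r, 0 ≤ Lχ r := fun r => zero_le_one.trans (hLχ1 r)
  obtain ⟨V, hVc, a, ha, U, G, hUc, hUm, hU0, hGc, hGm, hG0, hVlow, hVup, hVd⟩ :=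
    hM₁.exists_iss_lyapunov hp₁ (g := fun r => mγ₁ r + H r + Lχ r ^ 2) (by fun_prop)
      (fun r s hrs => add_le_add (add_le_add (hmγ₁m hrs) (hHm hrs))
        (pow_le_pow_left₀ (hLχ0 r) (hLχm hrs) 2))
      (fun r => by linarith [hmγ₁1 r, hH0 r, sq_nonneg (Lχ r)])
  set w := M₁ *ᵥ N₁
  have hρ₁c := hρ₁_smooth.continuous
  obtain ⟨ρ, hρ_smooth, hρ⟩ := exists_smooth_gt (f := fun x =>
    ρ₁ x + G ‖x • w‖ * ‖w‖ ^ 2 + 2 + H ‖x‖ + Lχ ‖x‖ ^ 2) (by fun_prop)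
  obtain ⟨β, hβ_smooth, hβ⟩ := exists_smooth_gt (f := fun x => H ‖x‖) (by fun_prop)
  refine ⟨ρ, hρ_smooth, fun s => ?_, fun z => V z.1 + z.2.1 ^ 2 / 2 + V₂ z.2.2, by fun_prop,
    fun s => min a (min (1 / 2) a₂) * s ^ 2, fun s => (U s + 1 + U₂ s) * s ^ 2, ?_, ?_, ?_,
    β, hβ_smooth, fun s => (hH0 _).trans_lt (hβ s), ?_⟩
  · have h := hρ s
    have hG := mul_nonneg (hG0 ‖s • w‖) (sq_nonneg ‖w‖)
    linarith [hρ₁ s, hH0 ‖s‖, sq_nonneg (Lχ ‖s‖)]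
  · exact isClassKInfty_mul_sq continuous_const monotone_const
      (lt_min ha (lt_min one_half_pos ha₂)) fun _ => le_rfl
  · exact isClassKInfty_mul_sq (by fun_prop)
      (fun r s hrs => add_le_add (add_le_add_left (hUm hrs) 1) (hU₂m hrs)) one_pos
      (fun s => by linarith [hU0 s, hU₂0 s])
  · rintro ⟨η₁, x₁, η₂⟩
    set z := (η₁, x₁, η₂) with hz
    have h1 : ‖η₁‖ ≤ ‖z‖ := norm_fst_le z
    have h23 : ‖(x₁, η₂)‖ ≤ ‖z‖ := norm_snd_le z
    have h2 : ‖x₁‖ ≤ ‖z‖ := (norm_fst_le (x₁, η₂)).trans h23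
    have h3 : ‖η₂‖ ≤ ‖z‖ := (norm_snd_le (x₁, η₂)).trans h23
    have hx : x₁ ^ 2 = ‖x₁‖ ^ 2 := by rw [Real.norm_eq_abs, sq_abs]
    change _ ≤ V η₁ + x₁ ^ 2 / 2 + V₂ η₂ ∧ V η₁ + x₁ ^ 2 / 2 + V₂ η₂ ≤ _
    constructor
    · set c := min a (min (1 / 2) a₂)
      have hc0 : 0 ≤ c := (lt_min ha (lt_min one_half_pos ha₂)).le
      have e1 := mul_sq_norm_prod_le (H := fun _ => c) (fun _ => hc0) z
      have e2 := mul_sq_norm_prod_le (H := fun _ => c) (fun _ => hc0) z.2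
      have c1 : c * ‖η₁‖ ^ 2 ≤ a * ‖η₁‖ ^ 2 := by gcongr; exact min_le_left _ _
      have c2 : c * ‖x₁‖ ^ 2 ≤ 1 / 2 * ‖x₁‖ ^ 2 := by
        gcongr; exact (min_le_right _ _).trans (min_le_left _ _)
      have c3 : c * ‖η₂‖ ^ 2 ≤ a₂ * ‖η₂‖ ^ 2 := by
        gcongr; exact (min_le_right _ _).trans (min_le_right _ _)
      simp only [hz] at e1 e2 ⊢
      linarith [hVlow η₁, hV₂low η₂]
    · have c1 : U ‖η₁‖ * ‖η₁‖ ^ 2 ≤ U ‖z‖ * ‖z‖ ^ 2 :=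
        mul_le_mul (hUm h1) (by gcongr) (sq_nonneg _) (hU0 _)
      have c2 : ‖x₁‖ ^ 2 ≤ ‖z‖ ^ 2 := by gcongr
      have c3 : U₂ ‖η₂‖ * ‖η₂‖ ^ 2 ≤ U₂ ‖z‖ * ‖z‖ ^ 2 :=
        mul_le_mul (hU₂m h3) (by gcongr) (sq_nonneg _) (hU₂0 _)
      nlinarith [hVup η₁, hV₂up η₂, sq_nonneg x₁]
  · intro η₁ x₁ η₂ ζ μ hμ
    have hfd : ∀ u s v, fderiv ℝ
        (fun z : (Fin p₁ → ℝ) × ℝ × (Fin p₂ → ℝ) => V z.1 + z.2.1 ^ 2 / 2 + V₂ z.2.2)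
        (η₁, x₁, η₂) (u, s, v) = fderiv ℝ V η₁ u + x₁ * s + fderiv ℝ V₂ η₂ v := by
      intro u s v
      have d1 := (hVc.differentiable one_ne_zero η₁).hasFDerivAt.comp (η₁, x₁, η₂)
        (hasFDerivAt_fst (𝕜 := ℝ))
      have d3 := (hV₂c.differentiable one_ne_zero η₂).hasFDerivAt.comp (η₁, x₁, η₂)
        ((hasFDerivAt_snd (𝕜 := ℝ)).comp (η₁, x₁, η₂) (hasFDerivAt_snd (𝕜 := ℝ)))
      have d2 := (((hasDerivAt_pow 2 x₁).div_const 2).comp_hasFDerivAt (η₁, x₁, η₂)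
        ((hasFDerivAt_fst (𝕜 := ℝ)).comp (η₁, x₁, η₂) (hasFDerivAt_snd (𝕜 := ℝ))))
      refine (DFunLike.congr_fun ((d1.add d2).add d3).fderiv (u, s, v)).trans ?_
      simp
    rw [hfd]
    have e1 := hVd η₁ (x₁ • w)
    have e2 := hV₂d η₂ (p' (x₁, η₁, ζ, μ))
    have hpb : G₂ ‖p' (x₁, η₁, ζ, μ)‖ * ‖p' (x₁, η₁, ζ, μ)‖ ^ 2 ≤
        H ‖x₁‖ * ‖x₁‖ ^ 2 + H ‖η₁‖ * ‖η₁‖ ^ 2 + H ‖ζ‖ * ‖ζ‖ ^ 2 := by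
      have hb := hLp (x₁, η₁, ζ) μ hμ
      have s1 := mul_sq_norm_prod_le hH0 (x₁, η₁, ζ)
      have s2 := mul_sq_norm_prod_le hH0 (η₁, ζ)
      have s3 : G₂ ‖p' (x₁, η₁, ζ, μ)‖ * ‖p' (x₁, η₁, ζ, μ)‖ ^ 2 ≤
          H ‖(x₁, η₁, ζ)‖ * ‖(x₁, η₁, ζ)‖ ^ 2 := by
        simp only [H, max_eq_left (norm_nonneg (x₁, η₁, ζ))]
        rw [mul_assoc, ← mul_pow]
        exact mul_le_mul (hG₂m hb) (pow_le_pow_left₀ (norm_nonneg _) hb 2) (sq_nonneg _) (hG₂0 _)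
      simp only at s1 s2
      linarith
    have hχb : χ₁' (η₁, x₁) ^ 2 ≤
        Lχ ‖η₁‖ ^ 2 * ‖η₁‖ ^ 2 + Lχ ‖x₁‖ ^ 2 * ‖x₁‖ ^ 2 := by
      have hb := hLχ (η₁, x₁) 0 rfl
      refine le_trans ?_ (mul_sq_norm_prod_le (H := fun r => Lχ r ^ 2)
        (fun r => sq_nonneg _) (η₁, x₁))
      rw [← mul_pow, ← sq_abs, ← Real.norm_eq_abs]
      exact pow_le_pow_left₀ (norm_nonneg _) hb 2
    have hρx : (ρ₁ x₁ + G ‖x₁ • w‖ * ‖w‖ ^ 2 + 2 + H ‖x₁‖ + Lχ ‖x₁‖ ^ 2) * x₁ ^ 2 ≤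
        ρ x₁ * x₁ ^ 2 := mul_le_mul_of_nonneg_right (hρ x₁).le (sq_nonneg _)
    have hβζ : H ‖ζ‖ * ζ ^ 2 ≤ β ζ * ζ ^ 2 := mul_le_mul_of_nonneg_right (hβ ζ).le (sq_nonneg _)
    have hg1 : γ₁ η₁ * ‖η₁‖ ^ 2 ≤ mγ₁ ‖η₁‖ * ‖η₁‖ ^ 2 :=
      mul_le_mul_of_nonneg_right (hmγ₁ η₁ 0 rfl) (sq_nonneg _)
    have hg2 : γ₂ η₂ * ‖η₂‖ ^ 2 ≤ mγ₂ ‖η₂‖ * ‖η₂‖ ^ 2 :=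
      mul_le_mul_of_nonneg_right (hmγ₂ η₂ 0 rfl) (sq_nonneg _)
    have hxw : ‖x₁ • w‖ ^ 2 = x₁ ^ 2 * ‖w‖ ^ 2 := by
      rw [norm_smul, mul_pow, Real.norm_eq_abs, sq_abs]
    have hx : ‖x₁‖ ^ 2 = x₁ ^ 2 := by rw [Real.norm_eq_abs, sq_abs]
    have hζ : ‖ζ‖ ^ 2 = ζ ^ 2 := by rw [Real.norm_eq_abs, sq_abs]
    rw [hxw] at e1
    rw [hx] at hχb hpb
    rw [hζ] at hpb
    have hcross : x₁ * ζ + x₁ * χ₁' (η₁, x₁) ≤ 2 * x₁ ^ 2 + ζ ^ 2 + χ₁' (η₁, x₁) ^ 2 := by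
      nlinarith [sq_nonneg (x₁ - ζ), sq_nonneg (x₁ - χ₁' (η₁, x₁)), sq_nonneg x₁, sq_nonneg ζ,
        sq_nonneg (χ₁' (η₁, x₁))]
    linarith [sq_nonneg ζ]
end

section
/- Let Φ ∈ ℝ^{n×n}, let Γ ∈ ℝ^{1×n} be a row vector, and let m = (m₁, …, m_q) ∈ ℝ^q be such that Ξ := Φ^q + Σ_{j=1}^q m_j Φ^{j−1} is invertible. Let M = C(m) ∈ ℝ^{q×q} be the companion matrix of m, let N = (0, …, 0, 1)ᵀ ∈ ℝ^q, and let Q ∈ ℝ^{q×n} be the matrix whose j-th row is Q_j = Γ Ξ^{−1} Φ^{j−1} for j = 1, …, q. Then M Q = Q Φ − N Γ. -/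
open Matrix

/-- The companion matrix `C(m)` of `m = (m₁,…,m_q)`: ones on the superdiagonal, zeros elsewhere
in the first `q-1` rows, and last row `(-m₁, -m₂, …, -m_q)`. -/
def companionMatrix {q : ℕ} (m : Fin q → ℝ) : Matrix (Fin q) (Fin q) ℝ :=
  Matrix.of fun i j =>
    if (i : ℕ) + 1 = q then -m j
    else if (j : ℕ) = (i : ℕ) + 1 then 1 else 0

/-- with `Ξ = Φ^q + Σ_{j=1}^q m_j Φ^{j-1}` invertible, `M = C(m)` the companion
matrix, `N = (0,…,0,1)ᵀ`, and `Q` the matrix with rows `Q_j = Γ Ξ⁻¹ Φ^{j-1}`, the generalized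
Sylvester equation `M Q = Q Φ − N Γ` holds. -/
theorem generalized_Sylvester_equation
    {n q : ℕ} (Φ : Matrix (Fin n) (Fin n) ℝ) (Γ : Matrix (Fin 1) (Fin n) ℝ)
    (m : Fin q → ℝ)
    (Ξ : Matrix (Fin n) (Fin n) ℝ)
    (hΞdef : Ξ = Φ ^ q + ∑ j : Fin q, m j • Φ ^ (j : ℕ))
    (hΞ : IsUnit Ξ)
    (M : Matrix (Fin q) (Fin q) ℝ) (hM : M = companionMatrix m)
    (N : Matrix (Fin q) (Fin 1) ℝ)
    (hN : N = Matrix.of fun (i : Fin q) (_ : Fin 1) => if ((i : ℕ) + 1 = q) then (1 : ℝ) else (0 : ℝ))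
    (Q : Matrix (Fin q) (Fin n) ℝ)
    (hQ : ∀ (i : Fin q) (k : Fin n), Q i k = (Γ * Ξ⁻¹ * Φ ^ (i : ℕ)) 0 k) :
    M * Q = Q * Φ - N * Γ := by
  have hrow : ∀ i k, (Q * Φ) i k = (Γ * Ξ⁻¹ * Φ ^ ((i : ℕ) + 1)) 0 k := by
    intro i k
    rw [pow_succ, ← Matrix.mul_assoc, Matrix.mul_apply, Matrix.mul_apply]
    simp only [hQ]
  have hΓ : Γ = Γ * Ξ⁻¹ * Φ ^ q + ∑ j : Fin q, m j • (Γ * Ξ⁻¹ * Φ ^ (j : ℕ)) := by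
    calc Γ = Γ * Ξ⁻¹ * Ξ := by
          rw [Matrix.mul_assoc, Matrix.nonsing_inv_mul _ ((Matrix.isUnit_iff_isUnit_det _).mp hΞ),
            Matrix.mul_one]
      _ = Γ * Ξ⁻¹ * (Φ ^ q + ∑ j : Fin q, m j • Φ ^ (j : ℕ)) := by rw [← hΞdef]
      _ = _ := by simp only [Matrix.mul_add, Matrix.mul_sum, Matrix.mul_smul]
  ext i k
  rw [Matrix.sub_apply, hrow, Matrix.mul_apply, Matrix.mul_apply (M := N), Fin.sum_univ_one, hM, hN]
  simp only [companionMatrix, Matrix.of_apply]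
  by_cases hi : (i : ℕ) + 1 = q
  · have hΓk := congrFun (congrFun hΓ 0) k
    simp only [Matrix.add_apply, Matrix.sum_apply, Matrix.smul_apply, smul_eq_mul, ← hQ] at hΓk
    simp only [hi, if_true, neg_mul, Finset.sum_neg_distrib, one_mul]
    linarith
  · have hlt : (i : ℕ) + 1 < q := by omega
    rw [Finset.sum_eq_single ⟨(i : ℕ) + 1, hlt⟩]
    · simp [hi, hQ]
    · intro j _ hj
      have hne : (j : ℕ) ≠ (i : ℕ) + 1 := fun h => hj (Fin.ext h)
      simp [hi, hne]
    · simp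
end

section
/- Fix an integer n ≥ 1 and ε ∈ (0,1). Then (i) for every Θ ∈ ℝ^{n×n}, D(Θ) := det(Θ)² + Ψ(1 + det(Θ)² − ε²) > 0; and (ii) the map O : ℝ^{n×n} → ℝ^{n×n} defined by O(Θ) = (det(Θ)/D(Θ)) · adj(Θ) is globally defined and C^∞. -/
open Matrix

noncomputable section

attribute [local instance] Matrix.normedAddCommGroup Matrix.normedSpace

/-- `κ(s) = e^{-1/s}` for `s > 0` and `κ(s) = 0` otherwise. -/
def kappa (s : ℝ) : ℝ := if 0 < s then Real.exp (-1 / s) else 0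

/-- `Ψ(s) = κ(1-s)/(κ(s) + κ(1-s))`. -/
def Psi (s : ℝ) : ℝ := kappa (1 - s) / (kappa s + kappa (1 - s))

/-- The regularizing denominator `D(Θ) = det(Θ)² + Ψ(1 + det(Θ)² − ε²)`. -/
def Dreg {n : ℕ} (ε : ℝ) (Θ : Matrix (Fin n) (Fin n) ℝ) : ℝ :=
  Θ.det ^ 2 + Psi (1 + Θ.det ^ 2 - ε ^ 2)

/-- The regularized inverse map `O(Θ) = (det(Θ)/D(Θ)) · adj(Θ)`. -/
def Oreg {n : ℕ} (ε : ℝ) (Θ : Matrix (Fin n) (Fin n) ℝ) : Matrix (Fin n) (Fin n) ℝ :=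
  (Θ.det / Dreg ε Θ) • Θ.adjugate

theorem kappa_eq_expNegInvGlue (s : ℝ) : kappa s = expNegInvGlue s := by
  rcases lt_or_ge 0 s with h | h
  · simp [kappa, expNegInvGlue, h, not_le.2 h, neg_div]
  · simp [kappa, expNegInvGlue, h, not_lt.2 h]

theorem Psi_eq_smoothTransition (s : ℝ) : Psi s = Real.smoothTransition (1 - s) := by
  simp [Psi, Real.smoothTransition, kappa_eq_expNegInvGlue, add_comm]

theorem Psi_nonneg (s : ℝ) : 0 ≤ Psi s := by
  rw [Psi_eq_smoothTransition]
  exact Real.smoothTransition.nonneg _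

theorem contDiff_Psi {k : ℕ∞} : ContDiff ℝ k Psi := by
  rw [funext Psi_eq_smoothTransition]
  exact Real.smoothTransition.contDiff.comp (contDiff_const.sub contDiff_id)

theorem Dreg_pos {n : ℕ} {ε : ℝ} (hε : ε ≠ 0) (Θ : Matrix (Fin n) (Fin n) ℝ) :
    0 < Dreg ε Θ := by
  unfold Dreg
  by_cases h : Θ.det = 0
  · rw [h, Psi_eq_smoothTransition]
    have : 0 < Real.smoothTransition (1 - (1 + 0 ^ 2 - ε ^ 2)) := by
      apply Real.smoothTransition.pos_of_pos
      have := sq_pos_of_ne_zero hε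
      linarith
    linarith
  · exact add_pos_of_pos_of_nonneg (sq_pos_of_ne_zero h) (Psi_nonneg _)

theorem contDiff_matrix_entry {m : Type*} [Fintype m] {k : WithTop ℕ∞} (i j : m) :
    ContDiff ℝ k (fun A : Matrix m m ℝ => A i j) :=
  (contDiff_apply_apply ℝ ℝ i j : ContDiff ℝ k (fun A : m → m → ℝ => A i j))

theorem ContDiff.matrix_det {E m : Type*} [NormedAddCommGroup E] [NormedSpace ℝ E]
    [Fintype m] [DecidableEq m] {k : WithTop ℕ∞} {A : E → Matrix m m ℝ}
    (hA : ∀ i j, ContDiff ℝ k (fun x => A x i j)) : ContDiff ℝ k (fun x => (A x).det) := by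
  simp only [Matrix.det_apply]
  exact ContDiff.sum fun σ _ => (contDiff_prod fun i _ => hA _ _).const_smul _

theorem contDiff_matrix_adjugate_entry {m : Type*} [Fintype m] [DecidableEq m]
    {k : WithTop ℕ∞} (i j : m) :
    ContDiff ℝ k (fun A : Matrix m m ℝ => A.adjugate i j) := by
  simp only [Matrix.adjugate_apply]
  refine ContDiff.matrix_det fun i' j' => ?_
  simp only [Matrix.updateRow_apply]
  split_ifs
  · exact contDiff_const
  · exact contDiff_matrix_entry _ _

theorem contDiff_Dreg {n : ℕ} {k : ℕ∞} (ε : ℝ) :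
    ContDiff ℝ k (fun Θ : Matrix (Fin n) (Fin n) ℝ => Dreg ε Θ) := by
  have hdet : ContDiff ℝ k (fun Θ : Matrix (Fin n) (Fin n) ℝ => Θ.det) :=
    ContDiff.matrix_det contDiff_matrix_entry
  exact (hdet.pow 2).add
    (contDiff_Psi.comp ((contDiff_const.add (hdet.pow 2)).sub contDiff_const))

/-- for `0 < ε < 1`, (i) `D(Θ) > 0` for every `Θ`, and (ii) the regularized
inverse map `O` is globally defined and `C^∞`. -/
theorem regularized_inverse_positive_and_smooth
    (n : ℕ) (hn : 1 ≤ n) (ε : ℝ) (hε : ε ∈ Set.Ioo (0 : ℝ) 1) :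
    (∀ Θ : Matrix (Fin n) (Fin n) ℝ, 0 < Dreg ε Θ) ∧
    ContDiff ℝ (⊤ : ℕ∞) (fun Θ : Matrix (Fin n) (Fin n) ℝ => Oreg ε Θ) := by
  have hpos := Dreg_pos (n := n) hε.1.ne'
  refine ⟨hpos, contDiff_pi' fun i => contDiff_pi' fun j => ?_⟩
  exact ((ContDiff.matrix_det contDiff_matrix_entry).div (contDiff_Dreg ε)
    fun Θ => (hpos Θ).ne').mul (contDiff_matrix_adjugate_entry i j)

end
end

section
/- Fix an integer n ≥ 1 and ε ∈ (0,1), and let O(Θ) = (det(Θ)/D(Θ)) · adj(Θ) with D(Θ) = det(Θ)² + Ψ(1 + det(Θ)² − ε²). Then for every Θ ∈ ℝ^{n×n} with det(Θ)² ≥ ε², the matrix Θ is invertible and O(Θ) = Θ^{−1}. -/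
open Matrix

noncomputable section

/-- `Ψ` vanishes on `[1, ∞)`. -/
theorem Psi_eq_zero_of_one_le {s : ℝ} (hs : 1 ≤ s) : Psi s = 0 := by
  simp [Psi, kappa, hs.not_gt]

/-- for `0 < ε < 1` and any `Θ` with `det(Θ)² ≥ ε²`, the matrix `Θ` is
invertible and the regularized inverse `O(Θ)` coincides with `Θ⁻¹`. -/
theorem regularized_inverse_exact
    (n : ℕ) (hn : 1 ≤ n) (ε : ℝ) (hε : ε ∈ Set.Ioo (0 : ℝ) 1)
    (Θ : Matrix (Fin n) (Fin n) ℝ) (hΘ : ε ^ 2 ≤ Θ.det ^ 2) :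
    IsUnit Θ ∧ Oreg ε Θ = Θ⁻¹ := by
  have hdet : Θ.det ≠ 0 :=
    sq_pos_iff.1 ((pow_pos hε.1 2).trans_le hΘ)
  refine ⟨(Θ.isUnit_iff_isUnit_det).2 hdet.isUnit, ?_⟩
  have hPsi : Psi (1 + Θ.det ^ 2 - ε ^ 2) = 0 := Psi_eq_zero_of_one_le (by linarith)
  rw [Oreg, Dreg, hPsi, add_zero, Matrix.inv_def, Ring.inverse_eq_inv']
  congr 1
  field_simp

end
end
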